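/- Let p be prime with p > 2^7 and p does not divide a·m... State instead: For any prime p and any integer a with gcd(a,p) = 1, the normalized Kloosterman sum satisfies |K_p(a)| ≤ 2. -/

import Mathlib

open Finset

noncomputable def Kl (m : ℕ) (a : ℤ) : ℂ :=
  (1 / Real.sqrt m) * ∑ x ∈ (Finset.range m).filter (fun x => Nat.Coprime x m),
    Complex.exp (2 * Real.pi * Complex.I *
      (((a * (x : ℤ) + ((((x : ZMod m)⁻¹ : ZMod m)).val : ℤ) : ℤ) : ℂ) / (m : ℂ)))

open Polynomial

theorem eq_zero_of_sq_eq_mul_sq_mul_squarefree {k : Type*} [Field k] {f A D : k[X]} {κ : k}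
    (hκ : κ ≠ 0) (hf : Squarefree f) (hu : ¬ IsUnit f) (h : A ^ 2 = C κ * (D ^ 2 * f)) :
    A = 0 ∧ D = 0 := by
  have hD : D = 0 := by
    by_contra hD
    have hf0 : f ≠ 0 := hf.ne_zero
    obtain ⟨π, hπ, hπf⟩ := WfDvdMonoid.exists_irreducible_factor hu hf0
    have hA : A ≠ 0 := by
      rintro rfl
      have : C κ * (D ^ 2 * f) ≠ 0 := by simp [hκ, hD, hf0]
      exact this (by rw [← h]; ring)
    have hπ' := hπ.prime
    have fA := FiniteMultiplicity.of_prime_left hπ' hA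
    have fD := FiniteMultiplicity.of_prime_left hπ' hD
    have h1 : emultiplicity π f = 1 := by
      apply le_antisymm
      · rw [squarefree_iff_emultiplicity_le_one] at hf
        exact (hf π).resolve_right hπ.not_isUnit
      · rw [← Nat.cast_one]
        exact le_emultiplicity_of_pow_dvd (by simpa using hπf)
    have h2 := congrArg (emultiplicity π) h
    rw [emultiplicity_pow hπ', emultiplicity_mul hπ', emultiplicity_mul hπ',
      emultiplicity_pow hπ', h1, fA.emultiplicity_eq_multiplicity,
      fD.emultiplicity_eq_multiplicity,
      emultiplicity_of_isUnit_right hπ.not_isUnit (isUnit_C.2 (isUnit_iff_ne_zero.2 hκ))] at h2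
    norm_cast at h2
    omega
  refine ⟨?_, hD⟩
  rw [hD] at h
  simpa using h

section Kloosterman

variable {p : ℕ} [Fact p.Prime]

/-- The discriminant `(X ^ p - X) ^ 2 - 4 * a` of `a * T ^ 2 - (X ^ p - X) * T + 1` in `T`. -/
noncomputable def kloostermanDisc (a : ZMod p) : (ZMod p)[X] := (X ^ p - X) ^ 2 - C (4 * a)

theorem two_ne_zero_zmod (hp2 : p ≠ 2) : (2 : ZMod p) ≠ 0 := by
  have : ((2 : ℕ) : ZMod p) ≠ 0 := by
    rw [Ne, ZMod.natCast_eq_zero_iff]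
    intro h
    exact hp2 ((Nat.prime_dvd_prime_iff_eq Fact.out Nat.prime_two).1 h)
  simpa using this

theorem squarefree_kloostermanDisc (hp2 : p ≠ 2) {a : ZMod p} (ha : a ≠ 0) :
    Squarefree (kloostermanDisc a) := by
  have h2 := two_ne_zero_zmod hp2
  apply Separable.squarefree
  refine ⟨C (-(4 * a)⁻¹), C (-(8 * a)⁻¹) * (X ^ p - X), ?_⟩
  have h4 : (4 : ZMod p) ≠ 0 := by
    rw [show (4 : ZMod p) = 2 * 2 by norm_num]; exact mul_ne_zero h2 h2
  have h8 : (8 : ZMod p) ≠ 0 := by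
    rw [show (8 : ZMod p) = 2 * 4 by norm_num]; exact mul_ne_zero h2 h4
  have hd : derivative (kloostermanDisc a) = C (-2) * (X ^ p - X) := by
    simp [kloostermanDisc, derivative_pow]
  have e1 : C (-(4 * a)⁻¹) * C (4 * a) = (-1 : (ZMod p)[X]) := by
    rw [← C_mul, neg_mul, inv_mul_cancel₀ (mul_ne_zero h4 ha)]; simp
  have e2 : C (-(8 * a)⁻¹) * C (-2 : ZMod p) = C ((4 * a)⁻¹) := by
    rw [← C_mul]; congr 1; field_simp; norm_num
  rw [hd, kloostermanDisc]
  have e3 : C (-(4 * a)⁻¹) = - C ((4 * a)⁻¹) := by simp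
  linear_combination (X ^ p - X) ^ 2 * e2 - e1 + (X ^ p - X) ^ 2 * e3

theorem natDegree_kloostermanDisc (a : ZMod p) : (kloostermanDisc a).natDegree = 2 * p := by
  have hp : 1 < p := (Fact.out : p.Prime).one_lt
  have h1 : (X ^ p - X : (ZMod p)[X]).natDegree = p := by
    rw [natDegree_sub_eq_left_of_natDegree_lt] <;> simp [hp]
  rw [kloostermanDisc, natDegree_sub_C, natDegree_pow, h1]

theorem eval_kloostermanDisc (a c : ZMod p) : (kloostermanDisc a).eval c = - (4 * a) := by
  simp [kloostermanDisc]

theorem not_isUnit_kloostermanDisc (a : ZMod p) : ¬ IsUnit (kloostermanDisc a) := by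
  intro h
  have := natDegree_eq_zero_of_isUnit h
  rw [natDegree_kloostermanDisc] at this
  have hp : 1 < p := (Fact.out : p.Prime).one_lt
  omega

theorem eq_zero_of_X_sub_C_pow_dvd (hp2 : p ≠ 2) {a : ZMod p} (ha : a ≠ 0) (c : ZMod p)
    {Q e l μ : ℕ} (hQ : Q = p ^ μ) (he : 2 * e = Q + 1) (hl : 2 * l + 2 * p ≤ Q + 1)
    {A D : (ZMod p)[X]} (hA : A.degree < l) (hD : D.degree < l)
    (h : (X - C c) ^ Q ∣ A + D * kloostermanDisc a ^ e) : A = 0 ∧ D = 0 := by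
  have hp : 1 < p := (Fact.out : p.Prime).one_lt
  set f := kloostermanDisc a with hf
  have h1 : (X - C c) ^ Q ∣ f ^ Q - C (- (4 * a)) := by
    have : f ^ Q - C (- (4 * a)) = (f - C (-(4 * a))) ^ Q := by
      rw [hQ, sub_pow_char_pow, ← C_pow, ZMod.pow_card_pow]
    rw [this]
    apply pow_dvd_pow_of_dvd
    rw [← eval_kloostermanDisc a c]
    exact X_sub_C_dvd_sub_C_eval
  have h2 : (X - C c) ^ Q ∣ A ^ 2 - C (-(4 * a)) * (D ^ 2 * f) := by
    have : A ^ 2 - C (-(4 * a)) * (D ^ 2 * f) =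
        (A + D * f ^ e) * (A - D * f ^ e) + D ^ 2 * f * (f ^ Q - C (- (4 * a))) := by
      have : f * f ^ Q = f ^ e * f ^ e := by rw [← pow_succ', ← pow_add, ← he, two_mul]
      linear_combination (-D ^ 2) * this
    rw [this]
    exact dvd_add (h.mul_right _) (h1.mul_left _)
  have h4 : (4 : ZMod p) ≠ 0 := by
    have := two_ne_zero_zmod hp2
    rw [show (4 : ZMod p) = 2 * 2 by norm_num]; exact mul_ne_zero this this
  refine eq_zero_of_sq_eq_mul_sq_mul_squarefree (κ := -(4 * a)) (f := f) (by simp [h4, ha])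
    (squarefree_kloostermanDisc hp2 ha) (not_isUnit_kloostermanDisc a) ?_
  rw [← sub_eq_zero]
  have key : ∀ B : (ZMod p)[X], B.degree < l → B.natDegree + 1 ≤ l ∨ B = 0 := by
    intro B hB
    rcases eq_or_ne B 0 with h0 | h0
    · exact Or.inr h0
    · left; exact (natDegree_lt_iff_degree_lt h0).2 hB
  apply eq_zero_of_dvd_of_natDegree_lt h2
  rw [natDegree_pow, natDegree_X_sub_C, mul_one]
  have a1 : (A ^ 2).natDegree < Q := by
    rcases key A hA with h | h
    · rw [natDegree_pow]; omega
    · simp [h]; omega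
  have a2 : (C (-(4 * a)) * (D ^ 2 * f)).natDegree < Q := by
    rcases key D hD with h | h
    · refine lt_of_le_of_lt (natDegree_C_mul_le _ _) (lt_of_le_of_lt natDegree_mul_le ?_)
      rw [natDegree_pow, hf, natDegree_kloostermanDisc]; omega
    · simp [h]; omega
  exact lt_of_le_of_lt (natDegree_sub_le _ _) (max_lt a1 a2)

theorem eq_zero_of_sum_mul_pow_eq_zero {R : Type*} [CommRing R] [IsDomain R] {W : R}
    (hW : W ≠ 0) {m : ℕ} (B : ℕ → R) (hB : ∀ i < m, W ∣ B i → B i = 0)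
    (h : ∑ i ∈ range m, B i * W ^ i = 0) : ∀ i < m, B i = 0 := by
  induction m generalizing B with
  | zero => simp
  | succ m ih =>
    rw [sum_range_succ'] at h
    have e : ∑ i ∈ range m, B (i + 1) * W ^ (i + 1) = W * ∑ i ∈ range m, B (i + 1) * W ^ i := by
      rw [mul_sum]; exact sum_congr rfl fun i _ => by ring
    rw [e, pow_zero, mul_one] at h
    have h0 : B 0 = 0 := hB 0 (Nat.succ_pos m)
      ⟨-∑ i ∈ range m, B (i + 1) * W ^ i, by linear_combination h⟩
    rw [h0, add_zero] at h
    have h' := ih (fun i => B (i + 1)) (fun i hi => hB (i + 1) (by omega))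
      ((mul_eq_zero.1 h).resolve_left hW)
    intro i hi
    rcases i with _ | i
    · exact h0
    · exact h' i (by omega)


theorem exists_sum_expand_eq_zero (a : ZMod p) {Q e l m : ℕ} (he : 2 * e = Q + 1)
    (hN : l * Q + p * (Q + 1) + m < 2 * l * m) :
    ∃ A D : ℕ → (ZMod p)[X], (∀ i, (A i).degree < l) ∧ (∀ i, (D i).degree < l) ∧
      (∃ i < m, A i ≠ 0 ∨ D i ≠ 0) ∧
      ∑ i ∈ range m,
        (expand (ZMod p) Q (A i) + expand (ZMod p) Q (D i) * kloostermanDisc a ^ e) * X ^ i = 0 := by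
  classical
  set f := kloostermanDisc a with hf
  let Φ : (Fin m → degreeLT (ZMod p) l × degreeLT (ZMod p) l) →ₗ[ZMod p] (ZMod p)[X] :=
    { toFun := fun v => ∑ i : Fin m, (expand (ZMod p) Q (v i).1 +
        expand (ZMod p) Q (v i).2 * f ^ e) * X ^ (i : ℕ)
      map_add' := by
        intro v w
        rw [← sum_add_distrib]
        refine sum_congr rfl fun i _ => ?_
        simp only [Pi.add_apply, Prod.fst_add, Prod.snd_add, Submodule.coe_add, map_add]
        ring
      map_smul' := by
        intro r v
        rw [RingHom.id_apply, smul_sum]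
        refine sum_congr rfl fun i _ => ?_
        simp only [Pi.smul_apply, Prod.smul_fst, Prod.smul_snd, Submodule.coe_smul,
          smul_eq_C_mul, map_mul, expand_C]
        ring }
  have key : ∀ B : (ZMod p)[X], B.degree < l → (expand (ZMod p) Q B).natDegree ≤ l * Q := by
    intro B hB
    rw [natDegree_expand]
    apply Nat.mul_le_mul_right
    exact natDegree_le_of_degree_le hB.le
  have hfe : (f ^ e).natDegree ≤ p * (Q + 1) := by
    rw [natDegree_pow, hf, natDegree_kloostermanDisc, ← he]
    exact le_of_eq (by ring)
  have hΦ : ∀ v, Φ v ∈ degreeLT (ZMod p) (l * Q + p * (Q + 1) + m) := by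
    intro v
    rw [show Φ v = ∑ i : Fin m, (expand (ZMod p) Q (v i).1 +
      expand (ZMod p) Q (v i).2 * f ^ e) * X ^ (i : ℕ) from rfl]
    refine Submodule.sum_mem _ fun i _ => ?_
    rw [mem_degreeLT]
    refine lt_of_le_of_lt (degree_le_natDegree) ?_
    rw [Nat.cast_lt]
    refine lt_of_le_of_lt natDegree_mul_le ?_
    rw [natDegree_X_pow]
    have h1 := key _ (mem_degreeLT.1 (v i).1.2)
    have h2 := key _ (mem_degreeLT.1 (v i).2.2)
    have h3 : (expand (ZMod p) Q ((v i).2 : (ZMod p)[X]) * f ^ e).natDegree ≤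
        l * Q + p * (Q + 1) := natDegree_mul_le.trans (add_le_add h2 hfe)
    have h4 := natDegree_add_le (expand (ZMod p) Q ((v i).1 : (ZMod p)[X]))
      (expand (ZMod p) Q ((v i).2 : (ZMod p)[X]) * f ^ e)
    have h5 := h4.trans (max_le (h1.trans (Nat.le_add_right _ _)) h3)
    have := i.2
    omega
  let Φ' := Φ.codRestrict _ hΦ
  have hfin : ∀ n, Module.finrank (ZMod p) (degreeLT (ZMod p) n) = n := fun n => by
    rw [(degreeLTEquiv (ZMod p) n).finrank_eq, Module.finrank_fin_fun]
  have hfd : ∀ n, FiniteDimensional (ZMod p) (degreeLT (ZMod p) n) := fun n =>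
    (degreeLTEquiv (ZMod p) n).symm.finiteDimensional
  have := hfd l
  have := hfd (l * Q + p * (Q + 1) + m)
  have hker : LinearMap.ker Φ' ≠ ⊥ := by
    apply LinearMap.ker_ne_bot_of_finrank_lt
    rw [hfin, Module.finrank_pi_fintype]
    simp only [Module.finrank_prod, hfin, sum_const, card_univ, Fintype.card_fin, smul_eq_mul]
    calc _ < _ := hN
      _ = _ := by ring
  obtain ⟨v, hv, hv0⟩ := Submodule.exists_mem_ne_zero_of_ne_bot hker
  have hv' : Φ v = 0 := by
    have := congrArg Subtype.val (LinearMap.mem_ker.1 hv)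
    simpa [Φ'] using this
  refine ⟨fun i => if h : i < m then (v ⟨i, h⟩).1 else 0,
    fun i => if h : i < m then (v ⟨i, h⟩).2 else 0, ?_, ?_, ?_, ?_⟩
  · intro i
    dsimp only
    split_ifs with h
    · exact mem_degreeLT.1 (v ⟨i, h⟩).1.2
    · rw [degree_zero]; exact WithBot.bot_lt_coe _
  · intro i
    dsimp only
    split_ifs with h
    · exact mem_degreeLT.1 (v ⟨i, h⟩).2.2
    · rw [degree_zero]; exact WithBot.bot_lt_coe _
  · by_contra! hcon
    apply hv0
    funext i
    have := hcon i i.2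
    simp only [Fin.is_lt, dif_pos, Fin.eta, Submodule.coe_eq_zero] at this
    exact Prod.ext this.1 this.2
  · rw [← hv', sum_range]
    simp only [Fin.is_lt, dif_pos, Fin.eta]
    rfl

theorem expand_pow_eq_pow {μ : ℕ} (B : (ZMod p)[X]) : expand (ZMod p) (p ^ μ) B = B ^ p ^ μ := by
  induction μ with
  | zero => simp
  | succ μ ih => rw [pow_succ', expand_mul, ih, map_pow, ZMod.expand_card, ← pow_mul, mul_comm]

/-- The Stepanov bound for the number of ordinates of twisted rational points. -/
theorem card_le_of_pow_eq_add (hp2 : p ≠ 2) {a : ZMod p} (ha : a ≠ 0) (c : ZMod p)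
    {L : Type*} [Field L] [Algebra (ZMod p) L]
    {Q e l m μ : ℕ} (hQ : Q = p ^ μ) (he : 2 * e = Q + 1) (hl : 2 * l + 2 * p ≤ Q + 1)
    (hN : l * Q + p * (Q + 1) + m < 2 * l * m) (Y : Finset L)
    (hY : ∀ y ∈ Y, y ^ Q ^ 2 = y + algebraMap (ZMod p) L c)
    (hv : ∀ y ∈ Y, ∃ v : L, v ^ Q ^ 2 = v ∧ aeval y (kloostermanDisc a) = v ^ 2) :
    #Y ≤ m * Q + l + p * (Q + 1) := by
  classical
  have hQ0 : 0 < Q := by rw [hQ]; exact pow_pos (Fact.out : p.Prime).pos _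
  have : CharP L p := charP_of_injective_algebraMap (algebraMap (ZMod p) L).injective p
  have : ExpChar L p := ExpChar.prime Fact.out
  obtain ⟨A, D, hA, hD, ⟨i₀, hi₀, hne⟩, hsum⟩ := exists_sum_expand_eq_zero a he hN
  set f := kloostermanDisc a with hf
  set P : (ZMod p)[X] := ∑ i ∈ range m, (A i + D i * f ^ e) * ((X - C c) ^ Q) ^ i with hP
  have hP0 : P ≠ 0 := by
    intro h0
    have h1 := eq_zero_of_sum_mul_pow_eq_zero (W := (X - C c) ^ Q)
      (pow_ne_zero _ (X_sub_C_ne_zero c)) (fun i => A i + D i * f ^ e) (m := m) ?_ h0 i₀ hi₀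
    · have := eq_zero_of_X_sub_C_pow_dvd hp2 ha c hQ he hl (hA i₀) (hD i₀) (h1 ▸ dvd_zero _)
      rcases hne with h | h
      · exact h this.1
      · exact h this.2
    · intro i _ hdvd
      have := eq_zero_of_X_sub_C_pow_dvd hp2 ha c hQ he hl (hA i) (hD i) hdvd
      simp [this.1, this.2]
  have hdeg : P.natDegree ≤ m * Q + l + p * (Q + 1) := by
    apply natDegree_sum_le_of_forall_le
    intro i hi
    have hB : ∀ B : (ZMod p)[X], B.degree < l → B.natDegree ≤ l :=
      fun B hB => natDegree_le_of_degree_le hB.le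
    have hfe : (f ^ e).natDegree ≤ p * (Q + 1) := by
      rw [natDegree_pow, hf, natDegree_kloostermanDisc, ← he]
      exact le_of_eq (by ring)
    have h1 : (A i + D i * f ^ e).natDegree ≤ l + p * (Q + 1) :=
      (natDegree_add_le _ _).trans (max_le ((hB _ (hA i)).trans (Nat.le_add_right _ _))
        (natDegree_mul_le.trans (add_le_add (hB _ (hD i)) hfe)))
    have h2 : (((X - C c : (ZMod p)[X]) ^ Q) ^ i).natDegree ≤ m * Q := by
      rw [natDegree_pow, natDegree_pow, natDegree_X_sub_C, mul_one]
      exact Nat.mul_le_mul_right _ (mem_range.1 hi).le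
    exact natDegree_mul_le.trans (by omega)
  have hroot : ∀ y ∈ Y, aeval y P = 0 := by
    intro y hy
    obtain ⟨v, hv1, hv2⟩ := hv y hy
    have hpw : ∀ B : (ZMod p)[X], (aeval y B) ^ Q = aeval y (expand (ZMod p) Q B) := by
      intro B; rw [hQ, expand_pow_eq_pow, map_pow]
    have hv3 : (aeval y f ^ e) ^ Q = aeval y f ^ e := by
      rw [hv2, ← pow_mul, ← pow_mul, ← pow_mul, ← mul_assoc, he]
      calc v ^ ((Q + 1) * Q) = v ^ Q ^ 2 * v ^ Q := by rw [← pow_add]; congr 1; ring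
        _ = v ^ (Q + 1) := by rw [hv1]; ring
    have hc : ∀ i, ((aeval y ((X - C c) ^ Q)) ^ i) ^ Q = y ^ i := by
      intro i
      rw [← pow_mul, mul_comm, pow_mul]
      congr 1
      have e1 : (X - C c : (ZMod p)[X]) ^ Q = X ^ Q - C c := by
        rw [hQ, sub_pow_char_pow, ← C_pow, ZMod.pow_card_pow]
      rw [e1, map_sub, map_pow, aeval_X, aeval_C, hQ, sub_pow_char_pow, ← hQ, ← pow_mul, ← sq, hY y hy,
        ← map_pow, hQ, ZMod.pow_card_pow, add_sub_cancel_right]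
    have : (aeval y P) ^ Q = 0 := by
      rw [hP, map_sum, hQ, sum_pow_char_pow, ← hQ]
      have h0 := congrArg (aeval y) hsum
      rw [map_sum, map_zero] at h0
      rw [← h0]
      refine sum_congr rfl fun i _ => ?_
      rw [map_mul, map_pow _ _ i, mul_pow, hc, map_mul, map_pow _ X, aeval_X]
      congr 1
      rw [map_add, map_add, map_mul, map_mul, hQ, add_pow_char_pow, ← hQ, mul_pow, hpw, hpw, map_pow,
        hv3]
    exact pow_eq_zero_iff hQ0.ne' |>.1 this
  have hPL : P.map (algebraMap (ZMod p) L) ≠ 0 := by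
    rwa [Ne, Polynomial.map_eq_zero]
  have hsub : Y ⊆ (P.map (algebraMap (ZMod p) L)).roots.toFinset := by
    intro y hy
    rw [Multiset.mem_toFinset, mem_roots hPL, IsRoot.def, eval_map_algebraMap]
    exact hroot y hy
  calc #Y ≤ _ := card_le_card hsub
    _ ≤ _ := Multiset.toFinset_card_le _
    _ ≤ _ := card_roots' _
    _ ≤ _ := by rwa [natDegree_map]

section FixedPoints

variable {L : Type*} [Field L]

variable (p L) in
/-- The elements of the field with `p ^ n` elements inside `L`. -/
noncomputable def frobFixed [DecidableEq L] (n : ℕ) : Finset L :=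
  (X ^ p ^ n - X : L[X]).roots.toFinset

theorem mem_frobFixed [DecidableEq L] {n : ℕ} (hn : n ≠ 0) {x : L} :
    x ∈ frobFixed p L n ↔ x ^ p ^ n = x := by
  have hp : 1 < p := (Fact.out : p.Prime).one_lt
  have h : (X ^ p ^ n - X : L[X]) ≠ 0 := FiniteField.X_pow_card_pow_sub_X_ne_zero L hn hp
  rw [frobFixed, Multiset.mem_toFinset, mem_roots h]
  simp [sub_eq_zero]

variable [Algebra (ZMod p) L]

/-- The trace of `a * x + x⁻¹`, as a sum of Frobenius conjugates. -/
noncomputable def kloostermanTrace (a : ZMod p) (n : ℕ) (x : L) : L :=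
  ∑ i ∈ range n, (algebraMap (ZMod p) L a * x ^ p ^ i + (x ^ p ^ i)⁻¹)

theorem pow_pow_eq_add_kloostermanTrace {a : ZMod p} {x y : L}
    (h : y ^ p - y = algebraMap (ZMod p) L a * x + x⁻¹) (n : ℕ) :
    y ^ p ^ n = y + kloostermanTrace a n x := by
  have : CharP L p := charP_of_injective_algebraMap (algebraMap (ZMod p) L).injective p
  have : ExpChar L p := ExpChar.prime Fact.out
  induction n with
  | zero => simp [kloostermanTrace]
  | succ n ih =>
    have h1 : (y ^ p - y) ^ p ^ n = algebraMap (ZMod p) L a * x ^ p ^ n + (x ^ p ^ n)⁻¹ := by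
      rw [h, add_pow_char_pow, mul_pow, inv_pow, ← map_pow, ZMod.pow_card_pow]
    rw [sub_pow_char_pow, ← pow_mul, ← pow_succ', ih] at h1
    rw [kloostermanTrace, sum_range_succ, ← h1, kloostermanTrace]
    ring

theorem mem_range_algebraMap_of_pow_eq_self {z : L} (h : z ^ p = z) :
    ∃ c : ZMod p, algebraMap (ZMod p) L c = z := by
  have : CharP L p := charP_of_injective_algebraMap (algebraMap (ZMod p) L).injective p
  have h1 := (Subfield.mem_bot_iff_pow_eq_self (F := L) (p := p)).2 h
  have h2 : (⊥ : Subfield L) ≤ (algebraMap (ZMod p) L).fieldRange := bot_le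
  exact RingHom.mem_fieldRange.1 (h2 h1)

theorem kloostermanTrace_mem_range (a : ZMod p) {n : ℕ} {x : L} (hx : x ^ p ^ n = x) :
    ∃ c : ZMod p, algebraMap (ZMod p) L c = kloostermanTrace a n x := by
  have : CharP L p := charP_of_injective_algebraMap (algebraMap (ZMod p) L).injective p
  have : ExpChar L p := ExpChar.prime Fact.out
  apply mem_range_algebraMap_of_pow_eq_self
  have h1 : kloostermanTrace a n x ^ p = ∑ i ∈ range n,
      (algebraMap (ZMod p) L a * x ^ p ^ (i + 1) + (x ^ p ^ (i + 1))⁻¹) := by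
    rw [kloostermanTrace, sum_pow_char]
    refine sum_congr rfl fun i _ => ?_
    rw [add_pow_char, mul_pow, ← map_pow, ZMod.pow_card, inv_pow, ← pow_mul, ← pow_succ]
  have h2 := sum_range_succ' (fun i => algebraMap (ZMod p) L a * x ^ p ^ i + (x ^ p ^ i)⁻¹) n
  rw [sum_range_succ, hx] at h2
  simp only [pow_zero, pow_one] at h2
  rw [h1, kloostermanTrace]
  exact (add_right_cancel h2).symm

theorem card_kloostermanTrace_eq_le [IsAlgClosed L] [DecidableEq L] (hp2 : p ≠ 2) {a : ZMod p}
    (ha : a ≠ 0) (c : ZMod p)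
    {Q e l m μ : ℕ} (hμ : μ ≠ 0) (hQ : Q = p ^ μ) (he : 2 * e = Q + 1)
    (hl : 2 * l + 2 * p ≤ Q + 1) (hN : l * Q + p * (Q + 1) + m < 2 * l * m) :
    #{x ∈ frobFixed p L (2 * μ) |
      x ≠ 0 ∧ kloostermanTrace a (2 * μ) x = algebraMap (ZMod p) L c} * p ≤
        (m * Q + l + p * (Q + 1)) * 2 := by
  classical
  have hp : 1 < p := (Fact.out : p.Prime).one_lt
  have : CharP L p := charP_of_injective_algebraMap (algebraMap (ZMod p) L).injective p
  have : ExpChar L p := ExpChar.prime Fact.out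
  set α := algebraMap (ZMod p) L a with hα
  have hα0 : α ≠ 0 := by rwa [hα, Ne, map_eq_zero]
  have hn : 2 * μ ≠ 0 := by omega
  set S := {x ∈ frobFixed p L (2 * μ) |
    x ≠ 0 ∧ kloostermanTrace a (2 * μ) x = algebraMap (ZMod p) L c} with hS
  let g : L → L[X] := fun x => X ^ p - X - C (α * x + x⁻¹)
  have hgdeg : ∀ x, (g x).natDegree = p := by
    intro x
    simp only [g]
    rw [natDegree_sub_C, natDegree_sub_eq_left_of_natDegree_lt] <;> simp [hp]
  have hg0 : ∀ x, g x ≠ 0 := fun x h => by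
    have := hgdeg x
    rw [h, natDegree_zero] at this
    omega
  have hg : ∀ x y, y ∈ (g x).roots.toFinset ↔ y ^ p - y = α * x + x⁻¹ := by
    intro x y
    rw [Multiset.mem_toFinset, mem_roots (hg0 x)]
    simp [g, sub_eq_zero]
  let Y := S.biUnion fun x => (g x).roots.toFinset
  have hYcard : #Y ≤ m * Q + l + p * (Q + 1) := by
    apply card_le_of_pow_eq_add hp2 ha c hQ he hl hN
    · intro y hy
      obtain ⟨x, hx, hxy⟩ := mem_biUnion.1 hy
      rw [hg] at hxy
      rw [hS, mem_filter] at hx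
      rw [hQ, ← pow_mul, mul_comm, pow_pow_eq_add_kloostermanTrace hxy, hx.2.2]
    · intro y hy
      obtain ⟨x, hx, hxy⟩ := mem_biUnion.1 hy
      rw [hg] at hxy
      rw [hS, mem_filter, mem_frobFixed hn] at hx
      have hx0 := hx.2.1
      refine ⟨α * x - x⁻¹, ?_, ?_⟩
      · rw [hQ, ← pow_mul, mul_comm μ, sub_pow_char_pow, mul_pow, inv_pow, hx.1, hα, ← map_pow,
          ZMod.pow_card_pow]
      · have : aeval y (kloostermanDisc a) = (y ^ p - y) ^ 2 - 4 * α := by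
          simp only [kloostermanDisc, map_sub, map_pow, aeval_X, aeval_C, map_mul, map_ofNat, hα]
        rw [this, hxy]
        field_simp
        ring
  refine le_trans ?_ (Nat.mul_le_mul_right 2 hYcard)
  refine card_mul_le_card_mul (fun x y => y ^ p - y = α * x + x⁻¹) ?_ ?_
  · intro x hx
    obtain ⟨y₀, hy₀⟩ := IsAlgClosed.exists_root (g x) (by
      rw [degree_eq_natDegree (hg0 x), hgdeg]
      exact_mod_cast (by omega))
    have hy₁ : y₀ ^ p - y₀ = α * x + x⁻¹ := by
      rw [← hg, Multiset.mem_toFinset, mem_roots (hg0 x)]; exact hy₀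
    have hinj : Function.Injective fun i : ZMod p => y₀ + algebraMap (ZMod p) L i := fun i j hij =>
      (algebraMap (ZMod p) L).injective (add_left_cancel hij)
    have hsub : Finset.univ.image (fun i : ZMod p => y₀ + algebraMap (ZMod p) L i) ⊆
        bipartiteAbove (fun x y => y ^ p - y = α * x + x⁻¹) Y x := by
      intro y hy
      obtain ⟨i, -, rfl⟩ := mem_image.1 hy
      have : (y₀ + algebraMap (ZMod p) L i) ^ p - (y₀ + algebraMap (ZMod p) L i) =
          α * x + x⁻¹ := by
        rw [add_pow_char, ← map_pow, ZMod.pow_card, ← hy₁]; ring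
      rw [mem_bipartiteAbove]
      exact ⟨mem_biUnion.2 ⟨x, hx, (hg _ _).2 this⟩, this⟩
    have := card_le_card hsub
    rwa [card_image_of_injective _ hinj, card_univ, ZMod.card] at this
  · intro y _
    let q : L[X] := C α * X ^ 2 + C (-(y ^ p - y)) * X + C 1
    have hq : q.natDegree = 2 := natDegree_quadratic hα0
    have hq0 : q ≠ 0 := fun h => by rw [h] at hq; simp at hq
    have hsub : bipartiteBelow (fun x y => y ^ p - y = α * x + x⁻¹) S y ⊆ q.roots.toFinset := by
      intro x hx
      rw [mem_bipartiteBelow, hS, mem_filter] at hx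
      have hx0 := hx.1.2.1
      rw [Multiset.mem_toFinset, mem_roots hq0]
      simp only [q, IsRoot.def, eval_add, eval_mul, eval_C, eval_pow, eval_X, hx.2]
      field_simp
      ring
    calc _ ≤ _ := card_le_card hsub
      _ ≤ _ := Multiset.toFinset_card_le _
      _ ≤ _ := card_roots' _
      _ = 2 := hq

end FixedPoints

section CharacterSum

variable (L : Type*) [Field L] [Algebra (ZMod p) L] [DecidableEq L]

theorem card_frobFixed [IsAlgClosed L] {n : ℕ} (hn : n ≠ 0) : #(frobFixed p L n) = p ^ n := by
  have hp : 1 < p := (Fact.out : p.Prime).one_lt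
  have : CharP L p := charP_of_injective_algebraMap (algebraMap (ZMod p) L).injective p
  have hsep : (X ^ p ^ n - X : L[X]).Separable :=
    galois_poly_separable p _ (dvd_pow_self p hn)
  rw [frobFixed, Multiset.toFinset_card_of_nodup (nodup_roots hsep),
    IsAlgClosed.card_roots_eq_natDegree, FiniteField.X_pow_card_pow_sub_X_natDegree_eq L hn hp]

/-- The number of nonzero `x` in the field with `p ^ n` elements such that `a * x + x⁻¹` has
trace `c`. -/
noncomputable def kloostermanCount (a : ZMod p) (n : ℕ) (c : ZMod p) : ℕ :=
  #{x ∈ frobFixed p L n | x ≠ 0 ∧ kloostermanTrace a n x = algebraMap (ZMod p) L c}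

/-- The Kloosterman sum over the field with `p ^ n` elements. -/
noncomputable def kloostermanSum (ψ : AddChar (ZMod p) ℂ) (a : ZMod p) (n : ℕ) : ℂ :=
  ∑ c : ZMod p, ψ c * kloostermanCount L a n c

theorem sum_kloostermanCount [IsAlgClosed L] (a : ZMod p) {n : ℕ} (hn : n ≠ 0) :
    ∑ c : ZMod p, kloostermanCount L a n c + 1 = p ^ n := by
  classical
  have hp : 0 < p := (Fact.out : p.Prime).pos
  have h0 : (0 : L) ∈ frobFixed p L n := by
    rw [mem_frobFixed hn]
    exact zero_pow (pow_pos hp n).ne'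
  rw [← card_frobFixed L hn, ← card_erase_add_one h0]
  congr 1
  simp only [kloostermanCount]
  rw [← card_biUnion]
  · congr 1
    ext x
    simp only [mem_biUnion, Finset.mem_univ, true_and, mem_filter, mem_erase]
    constructor
    · rintro ⟨c, h1, h2, -⟩
      exact ⟨h2, h1⟩
    · rintro ⟨h1, h2⟩
      obtain ⟨c, hc⟩ := kloostermanTrace_mem_range a ((mem_frobFixed hn).1 h2)
      exact ⟨c, h2, h1, hc.symm⟩
  · intro c _ d _ hcd
    rw [Function.onFun, disjoint_left]
    intro x hx hx'
    rw [mem_filter] at hx hx'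
    exact hcd ((algebraMap (ZMod p) L).injective (hx.2.2.symm.trans hx'.2.2))

theorem kloostermanCount_mul_le [IsAlgClosed L] (hp2 : p ≠ 2) {a : ZMod p} (ha : a ≠ 0)
    (c : ZMod p) {μ : ℕ} (hμ : 4 ≤ μ) :
    kloostermanCount L a (2 * μ) c * p ≤ (p ^ μ) ^ 2 + (4 * p + 5) * p ^ μ := by
  have hpp : p.Prime := Fact.out
  have hp3 : 3 ≤ p := by have := hpp.two_le; omega
  obtain ⟨E, hE⟩ : Odd (p ^ μ) := (hpp.odd_of_ne_two hp2).pow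
  have hbig : 9 * p ^ 2 ≤ p ^ μ := by
    calc 9 * p ^ 2 = 3 ^ 2 * p ^ 2 := by norm_num
      _ ≤ p ^ 2 * p ^ 2 := by gcongr
      _ = p ^ 4 := by ring
      _ ≤ p ^ μ := Nat.pow_le_pow_right hpp.pos hμ
  have hlt : 2 * p ^ 2 + 4 * p + 1 < p ^ μ + 1 := by nlinarith
  have hpE : p ≤ E + 1 := by nlinarith
  obtain ⟨l, hl⟩ := Nat.exists_eq_add_of_le hpE
  have key := card_kloostermanTrace_eq_le (L := L) hp2 ha c (Q := p ^ μ) (e := E + 1) (l := l)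
    (m := E + 1 + p + 1) (μ := μ) (by omega) rfl (by omega) (by omega) (by
      rw [hE] at hlt ⊢
      have : E = p + l - 1 := by omega
      zify [show 1 ≤ p + l by omega] at this
      zify at hlt ⊢
      rw [this] at hlt ⊢
      nlinarith)
  refine key.trans ?_
  rw [hE]
  have : E = p + l - 1 := by omega
  zify [show 1 ≤ p + l by omega] at this ⊢
  rw [this]
  nlinarith

theorem norm_kloostermanSum_le [IsAlgClosed L] (hp2 : p ≠ 2) {ψ : AddChar (ZMod p) ℂ} (hψ : ψ ≠ 1)
    {a : ZMod p} (ha : a ≠ 0) {μ : ℕ} (hμ : 4 ≤ μ) :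
    ‖kloostermanSum L ψ a (2 * μ)‖ ≤ (4 * p + 6) * (p : ℝ) ^ μ := by
  have hpp : p.Prime := Fact.out
  have hp0 : (0 : ℝ) < p := by exact_mod_cast hpp.pos
  set B : ℝ := (((p : ℝ) ^ μ) ^ 2 + (4 * p + 5) * (p : ℝ) ^ μ) / p with hB
  have hle : ∀ c, (kloostermanCount L a (2 * μ) c : ℝ) ≤ B := by
    intro c
    rw [hB, le_div_iff₀ hp0]
    exact_mod_cast kloostermanCount_mul_le L hp2 ha c hμ
  have h1 : kloostermanSum L ψ a (2 * μ) =
      ∑ c : ZMod p, ψ c * ((kloostermanCount L a (2 * μ) c - B : ℝ) : ℂ) := by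
    have : ∑ c : ZMod p, ψ c * ((kloostermanCount L a (2 * μ) c - B : ℝ) : ℂ) =
        kloostermanSum L ψ a (2 * μ) - (∑ c : ZMod p, ψ c) * B := by
      rw [kloostermanSum, sum_mul, ← sum_sub_distrib]
      refine sum_congr rfl fun c _ => ?_
      push_cast
      ring
    rw [this, AddChar.sum_eq_zero_of_ne_one hψ, zero_mul, sub_zero]
  have h2 : (∑ c : ZMod p, (kloostermanCount L a (2 * μ) c : ℝ)) + 1 = ((p : ℝ) ^ μ) ^ 2 := by
    rw [← pow_mul, mul_comm μ]
    exact_mod_cast sum_kloostermanCount L a (n := 2 * μ) (by omega)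
  have hQ1 : (1 : ℝ) ≤ (p : ℝ) ^ μ := one_le_pow₀ (by exact_mod_cast hpp.one_lt.le)
  calc ‖kloostermanSum L ψ a (2 * μ)‖
      ≤ ∑ c : ZMod p, ‖ψ c * ((kloostermanCount L a (2 * μ) c - B : ℝ) : ℂ)‖ := by
        rw [h1]; exact norm_sum_le _ _
    _ = ∑ c : ZMod p, (B - kloostermanCount L a (2 * μ) c) := by
        refine sum_congr rfl fun c _ => ?_
        rw [norm_mul, AddChar.norm_apply, one_mul, Complex.norm_real, Real.norm_eq_abs,
          abs_of_nonpos (by linarith [hle c]), neg_sub]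
    _ = p * B - (((p : ℝ) ^ μ) ^ 2 - 1) := by
        rw [sum_sub_distrib, sum_const, card_univ, ZMod.card, nsmul_eq_mul, ← h2]; ring
    _ = (4 * p + 5) * (p : ℝ) ^ μ + 1 := by
        rw [hB, mul_div_cancel₀ _ hp0.ne']; ring
    _ ≤ _ := by linarith

end CharacterSum

section LFunction

/-- On split monic polynomials with nonzero roots this is the sum of `a * x + x⁻¹` over the roots
`x`. -/
noncomputable def rootTrace {K : Type*} [Field K] (a : K) (f : K[X]) : K :=
  -(a * f.nextCoeff) - f.coeff 1 / f.coeff 0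

theorem rootTrace_mul {K : Type*} [Field K] (a : K) {f g : K[X]} (hf : f.Monic) (hg : g.Monic)
    (hf0 : f.coeff 0 ≠ 0) (hg0 : g.coeff 0 ≠ 0) :
    rootTrace a (f * g) = rootTrace a f + rootTrace a g := by
  rw [rootTrace, rootTrace, rootTrace, hf.nextCoeff_mul hg, mul_coeff_zero, mul_coeff_one]
  field_simp
  ring

theorem rootTrace_one {K : Type*} [Field K] (a : K) : rootTrace a (1 : K[X]) = 0 := by
  simp [rootTrace, nextCoeff, coeff_one]

theorem rootTrace_X_sub_C {K : Type*} [Field K] (a : K) {x : K} :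
    rootTrace a (X - C x) = a * x + x⁻¹ := by
  simp [rootTrace, nextCoeff_X_sub_C, coeff_X, coeff_C, div_neg]

theorem rootTrace_map {K K' : Type*} [Field K] [Field K'] (φ : K →+* K') (a : K) (f : K[X]) :
    rootTrace (φ a) (f.map φ) = φ (rootTrace a f) := by
  simp [rootTrace, nextCoeff_map φ.injective]

/-- The completely multiplicative function on monic polynomials attached to a Kloosterman sum. -/
noncomputable def polyChar (ψ : AddChar (ZMod p) ℂ) (a : ZMod p) (f : (ZMod p)[X]) : ℂ :=
  if f.coeff 0 = 0 then 0 else ψ (rootTrace a f)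

theorem polyChar_mul (ψ : AddChar (ZMod p) ℂ) (a : ZMod p) {f g : (ZMod p)[X]} (hf : f.Monic)
    (hg : g.Monic) : polyChar ψ a (f * g) = polyChar ψ a f * polyChar ψ a g := by
  by_cases hf0 : f.coeff 0 = 0
  · simp [polyChar, hf0]
  by_cases hg0 : g.coeff 0 = 0
  · simp [polyChar, hg0]
  · simp [polyChar, hf0, hg0, rootTrace_mul a hf hg hf0 hg0, AddChar.map_add_eq_mul]

variable (p) in
theorem finite_monic_natDegree_eq (n : ℕ) :
    {f : (ZMod p)[X] | f.Monic ∧ f.natDegree = n}.Finite := by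
  have e := (monicEquivDegreeLT (R := ZMod p) n).trans (degreeLTEquiv (ZMod p) n).toEquiv
  have : Finite {f : (ZMod p)[X] // f.Monic ∧ f.natDegree = n} := Finite.of_equiv _ e.symm
  exact Set.finite_coe_iff.1 this

variable (p) in
/-- The monic polynomials of degree `n` over `ZMod p`. -/
noncomputable def monicFinset (n : ℕ) : Finset (ZMod p)[X] :=
  (finite_monic_natDegree_eq p n).toFinset

theorem mem_monicFinset {n : ℕ} {f : (ZMod p)[X]} :
    f ∈ monicFinset p n ↔ f.Monic ∧ f.natDegree = n := by
  simp [monicFinset]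

/-- The coefficients of the `L`-function of a Kloosterman sum. -/
noncomputable def polyCharSum (ψ : AddChar (ZMod p) ℂ) (a : ZMod p) (n : ℕ) : ℂ :=
  ∑ f ∈ monicFinset p n, polyChar ψ a f

theorem polyCharSum_zero (ψ : AddChar (ZMod p) ℂ) (a : ZMod p) : polyCharSum ψ a 0 = 1 := by
  have : monicFinset p 0 = {1} := by
    ext f
    rw [mem_monicFinset, Finset.mem_singleton]
    constructor
    · rintro ⟨h1, h2⟩
      exact h1.natDegree_eq_zero.1 h2
    · rintro rfl
      exact ⟨monic_one, natDegree_one⟩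
  rw [polyCharSum, this, sum_singleton, polyChar, rootTrace_one]
  simp

theorem polyCharSum_one (ψ : AddChar (ZMod p) ℂ) (a : ZMod p) :
    polyCharSum ψ a 1 = ∑ x : ZMod p, if x = 0 then 0 else ψ (a * x + x⁻¹) := by
  rw [polyCharSum]
  symm
  refine sum_nbij' (fun x => X - C x) (fun f => - f.coeff 0) ?_ ?_ ?_ ?_ ?_
  · intro x _
    exact mem_monicFinset.2 ⟨monic_X_sub_C x, natDegree_X_sub_C x⟩
  · intros; exact Finset.mem_univ _
  · intro x _
    simp
  · intro f hf
    obtain ⟨h1, h2⟩ := mem_monicFinset.1 hf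
    conv_rhs => rw [h1.eq_X_add_C h2]
    simp
  · intro x _
    rw [polyChar, rootTrace_X_sub_C]
    simp

theorem polyCharSum_two {ψ : AddChar (ZMod p) ℂ} (hψ : ψ ≠ 1) {a : ZMod p} (ha : a ≠ 0) :
    polyCharSum ψ a 2 = p := by
  classical
  have h1 : polyCharSum ψ a 2 = ∑ x : ZMod p × ZMod p,
      if x.1 = 0 then 0 else ψ (x.2 * (-(a + x.1⁻¹))) := by
    rw [polyCharSum]
    symm
    have hdeg : ∀ x : ZMod p × ZMod p, (C 1 * X ^ 2 + C x.2 * X + C x.1).natDegree = 2 :=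
      fun x => natDegree_quadratic one_ne_zero
    refine sum_nbij' (fun x => C 1 * X ^ 2 + C x.2 * X + C x.1) (fun f => (f.coeff 0, f.coeff 1))
      ?_ ?_ ?_ ?_ ?_
    · intro x _
      exact mem_monicFinset.2 ⟨leadingCoeff_quadratic one_ne_zero, hdeg x⟩
    · intros; exact Finset.mem_univ _
    · intro x _
      ext <;> simp [coeff_X, coeff_C]
    · intro f hf
      obtain ⟨h1, h2⟩ := mem_monicFinset.1 hf
      have h3 : f.coeff 2 = 1 := by rw [← h2]; exact h1
      conv_rhs => rw [f.as_sum_range_C_mul_X_pow, h2]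
      simp [sum_range_succ, h3]
      ring
    · intro x _
      have c0 : (C 1 * X ^ 2 + C x.2 * X + C x.1).coeff 0 = x.1 := by simp
      have c1 : (C 1 * X ^ 2 + C x.2 * X + C x.1).coeff 1 = x.2 := by simp [coeff_C]
      rw [polyChar, rootTrace, nextCoeff_of_natDegree_pos (by rw [hdeg]; norm_num), hdeg, c0, c1]
      congr 2
      ring
  have h2 : ∀ c : ZMod p, (∑ b : ZMod p, if c = 0 then 0 else ψ (b * (-(a + c⁻¹)))) =
      if c = -a⁻¹ then (p : ℂ) else 0 := by
    intro c
    by_cases hc : c = 0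
    · simp [hc, ha]
    · have hiff : -(a + c⁻¹) = 0 ↔ c = -a⁻¹ := by
        rw [neg_eq_zero]
        constructor
        · intro h
          rw [← inv_inv c, eq_neg_of_add_eq_zero_right h, inv_neg]
        · rintro rfl
          simp [inv_neg]
      simp only [hc, if_false]
      rw [AddChar.sum_mulShift _ (AddChar.IsPrimitive.of_ne_one hψ), ZMod.card]
      simp only [hiff]
      split_ifs <;> simp
  rw [h1, Fintype.sum_prod_type]
  simp only [h2]
  simp

theorem polyCharSum_eq_zero {ψ : AddChar (ZMod p) ℂ} (hψ : ψ ≠ 1) {a : ZMod p} (ha : a ≠ 0)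
    {n : ℕ} (hn : 3 ≤ n) : polyCharSum ψ a n = 0 := by
  obtain ⟨s, hs⟩ := AddChar.ne_one_iff.1 hψ
  set t : ZMod p := -(s / a) with ht
  have hlt : (C t * X ^ (n - 1)).degree < (n : WithBot ℕ) :=
    (degree_C_mul_X_pow_le _ _).trans_lt (by exact_mod_cast (by omega))
  have hlt' : (-(C t * X ^ (n - 1))).degree < (n : WithBot ℕ) := by rwa [degree_neg]
  have hmem : ∀ g : (ZMod p)[X], g.degree < (n : WithBot ℕ) → ∀ f ∈ monicFinset p n,
      f + g ∈ monicFinset p n := by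
    intro g hg f hf
    obtain ⟨h1, h2⟩ := mem_monicFinset.1 hf
    have h3 : g.degree < f.degree := by rwa [degree_eq_natDegree h1.ne_zero, h2]
    exact mem_monicFinset.2 ⟨h1.add_of_left h3, by rw [natDegree_add_eq_left_of_degree_lt h3, h2]⟩
  have h1 : polyCharSum ψ a n = ψ s * polyCharSum ψ a n := by
    rw [polyCharSum, mul_sum]
    symm
    refine sum_nbij' (fun f => f + C t * X ^ (n - 1)) (fun f => f + -(C t * X ^ (n - 1)))
      (hmem _ hlt) (hmem _ hlt') (fun f _ => by ring) (fun f _ => by ring) ?_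
    intro f hf
    have hf2 := (mem_monicFinset.1 hf).2
    have hf2' := (mem_monicFinset.1 (hmem _ hlt f hf)).2
    have c0 : (f + C t * X ^ (n - 1)).coeff 0 = f.coeff 0 := by
      rw [coeff_add, coeff_C_mul, coeff_X_pow, if_neg (by omega)]; simp
    have c1 : (f + C t * X ^ (n - 1)).coeff 1 = f.coeff 1 := by
      rw [coeff_add, coeff_C_mul, coeff_X_pow, if_neg (by omega)]; simp
    have cn : (f + C t * X ^ (n - 1)).coeff (n - 1) = f.coeff (n - 1) + t := by
      rw [coeff_add, coeff_C_mul, coeff_X_pow, if_pos rfl, mul_one]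
    rw [polyChar, polyChar, rootTrace, rootTrace, nextCoeff_of_natDegree_pos (by omega),
      nextCoeff_of_natDegree_pos (by omega), hf2, hf2', c0, c1, cn]
    split_ifs
    · simp
    · rw [← AddChar.map_add_eq_mul]
      congr 1
      rw [ht]
      field_simp
      ring
  have h2 : (ψ s - 1) * polyCharSum ψ a n = 0 := by linear_combination -h1
  exact (mul_eq_zero.1 h2).resolve_left (sub_ne_zero.2 hs)

theorem sum_monicFinset_dvd (ψ : AddChar (ZMod p) ℂ) (a : ZMod p)
    {n k : ℕ} (hk : k ≤ n) {h : (ZMod p)[X]} (hh : h.Monic) (hdeg : h.natDegree = k)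
    [DecidablePred fun f : (ZMod p)[X] => h ∣ f] :
    ∑ f ∈ monicFinset p n with h ∣ f, polyChar ψ a f =
      polyChar ψ a h * polyCharSum ψ a (n - k) := by
  classical
  have : {f ∈ monicFinset p n | h ∣ f} = (monicFinset p (n - k)).image (h * ·) := by
    ext f
    rw [mem_filter, mem_image, mem_monicFinset]
    constructor
    · rintro ⟨⟨h1, h2⟩, g, rfl⟩
      have hg := hh.of_mul_monic_left h1
      refine ⟨g, mem_monicFinset.2 ⟨hg, ?_⟩, rfl⟩
      rw [hh.natDegree_mul hg] at h2
      omega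
    · rintro ⟨g, hg, rfl⟩
      obtain ⟨h1, h2⟩ := mem_monicFinset.1 hg
      refine ⟨⟨hh.mul h1, ?_⟩, dvd_mul_right _ _⟩
      rw [hh.natDegree_mul h1]
      omega
  rw [this, sum_image (fun x _ y _ hxy => mul_left_cancel₀ hh.ne_zero hxy), polyCharSum, mul_sum]
  exact sum_congr rfl fun g hg => polyChar_mul ψ a hh (mem_monicFinset.1 hg).1

end LFunction

section Recursion

variable {L : Type*} [Field L]

theorem rootTrace_prod_X_sub_C (α : L) {y : ℕ → L} (n : ℕ) (hy : ∀ i ∈ range n, y i ≠ 0) :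
    rootTrace α (∏ i ∈ range n, (X - C (y i))) = ∑ i ∈ range n, (α * y i + (y i)⁻¹) := by
  induction n with
  | zero => simp [rootTrace_one]
  | succ n ih =>
    have hy' : ∀ i ∈ range n, y i ≠ 0 := fun i hi =>
      hy i (mem_range.2 ((mem_range.1 hi).trans n.lt_succ_self))
    rw [prod_range_succ, sum_range_succ, rootTrace_mul _ (monic_prod_X_sub_C _ _)
      (monic_X_sub_C _), ih hy', rootTrace_X_sub_C]
    · rw [coeff_zero_eq_eval_zero, eval_prod, prod_ne_zero_iff]
      intro i hi
      simpa using hy' i hi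
    · simpa using hy n (self_mem_range_succ n)

variable (p) in
/-- The characteristic polynomial of an element `x` of the field with `p ^ n` elements. -/
noncomputable def frobPoly (n : ℕ) (x : L) : L[X] := ∏ i ∈ range n, (X - C (x ^ p ^ i))

omit [Fact p.Prime] in
theorem X_sub_C_dvd_frobPoly {n : ℕ} (hn : 0 < n) (x : L) : X - C x ∣ frobPoly p n x := by
  have h := dvd_prod_of_mem (fun i => X - C (x ^ p ^ i)) (mem_range.2 hn)
  rwa [pow_zero, pow_one] at h

omit [Fact p.Prime] in
theorem frobPoly_mul {d : ℕ} {x : L} (hx : x ^ p ^ d = x) (j : ℕ) :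
    frobPoly p (d * j) x = frobPoly p d x ^ j := by
  induction j with
  | zero => simp [frobPoly]
  | succ j ih =>
    rw [pow_succ', mul_add, mul_one, add_comm, ← ih, frobPoly, prod_range_add]
    congr 1
    refine prod_congr rfl fun i _ => ?_
    rw [pow_add, pow_mul, hx]

omit [Fact p.Prime] in
theorem pow_pow_eq_self_iff {x : L} {k : ℕ} :
    x ^ p ^ k = x ↔ Function.minimalPeriod (fun y : L => y ^ p) x ∣ k := by
  rw [← Function.isPeriodicPt_iff_minimalPeriod_dvd, Function.IsPeriodicPt, Function.IsFixedPt,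
    pow_iterate]

variable [Algebra (ZMod p) L]

theorem map_iterateFrobenius_map [ExpChar L p] (f : (ZMod p)[X]) (i : ℕ) :
    (f.map (algebraMap (ZMod p) L)).map (iterateFrobenius L p i) =
      f.map (algebraMap (ZMod p) L) := by
  ext m
  rw [coeff_map, coeff_map, iterateFrobenius_def, ← map_pow, ZMod.pow_card_pow]

theorem exists_map_eq_frobPoly {n : ℕ} {x : L} (hx : x ^ p ^ n = x) :
    ∃ g : (ZMod p)[X], g.map (algebraMap (ZMod p) L) = frobPoly p n x := by
  have : CharP L p := charP_of_injective_algebraMap (algebraMap (ZMod p) L).injective p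
  have : ExpChar L p := ExpChar.prime Fact.out
  rw [← mem_lifts, lifts_iff_coeff_lifts]
  intro m
  apply mem_range_algebraMap_of_pow_eq_self
  have h1 : (frobPoly p n x).map (frobenius L p) = frobPoly p n x := by
    have h2 := prod_range_succ' (fun i => X - C (x ^ p ^ i)) n
    rw [prod_range_succ, hx] at h2
    simp only [pow_zero, pow_one] at h2
    rw [frobPoly, Polynomial.map_prod, mul_right_cancel₀ (X_sub_C_ne_zero x) h2]
    refine prod_congr rfl fun i _ => ?_
    rw [Polynomial.map_sub, map_X, map_C, frobenius_def, ← pow_mul, ← pow_succ]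
  conv_rhs => rw [← h1]
  rw [coeff_map, frobenius_def]

theorem pow_dvd_map_of_pow_dvd_map {f : (ZMod p)[X]} {x : L} {j : ℕ}
    (h : (X - C x) ^ j ∣ f.map (algebraMap (ZMod p) L)) (i : ℕ) :
    (X - C (x ^ p ^ i)) ^ j ∣ f.map (algebraMap (ZMod p) L) := by
  have : CharP L p := charP_of_injective_algebraMap (algebraMap (ZMod p) L).injective p
  have : ExpChar L p := ExpChar.prime Fact.out
  have h1 := Polynomial.map_dvd (iterateFrobenius L p i) h
  rwa [map_iterateFrobenius_map, Polynomial.map_pow, Polynomial.map_sub, map_X, map_C,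
    iterateFrobenius_def] at h1

theorem minimalPeriod_pos_of_isRoot {f : (ZMod p)[X]} (hf : f ≠ 0) {x : L}
    (hx : (f.map (algebraMap (ZMod p) L)).IsRoot x) :
    0 < Function.minimalPeriod (fun y : L => y ^ p) x := by
  classical
  have : CharP L p := charP_of_injective_algebraMap (algebraMap (ZMod p) L).injective p
  have : ExpChar L p := ExpChar.prime Fact.out
  have hf' : f.map (algebraMap (ZMod p) L) ≠ 0 :=
    (Polynomial.map_ne_zero_iff (algebraMap (ZMod p) L).injective).2 hf
  have hroot : ∀ i, x ^ p ^ i ∈ (f.map (algebraMap (ZMod p) L)).roots.toFinset := by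
    intro i
    rw [Multiset.mem_toFinset, mem_roots hf', ← dvd_iff_isRoot, ← pow_one (X - C _)]
    exact pow_dvd_map_of_pow_dvd_map (by rwa [pow_one, dvd_iff_isRoot]) i
  obtain ⟨i, j, hij, h⟩ := Finite.exists_ne_map_eq_of_infinite
    (fun i => (⟨x ^ p ^ i, hroot i⟩ : (f.map (algebraMap (ZMod p) L)).roots.toFinset))
  rw [Subtype.mk.injEq] at h
  wlog hlt : i < j generalizing i j
  · exact this j i hij.symm h.symm (by omega)
  obtain ⟨k, rfl⟩ := Nat.exists_eq_add_of_lt hlt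
  have h1 : x ^ p ^ (k + 1) = x := by
    apply iterateFrobenius_inj L p i
    rw [iterateFrobenius_def, iterateFrobenius_def, h, ← pow_mul, ← pow_add]
    congr 2
    omega
  exact Nat.pos_of_dvd_of_pos (pow_pow_eq_self_iff.1 h1) k.succ_pos

theorem frobPoly_minimalPeriod_pow_dvd_iff {f : (ZMod p)[X]} (hf : f ≠ 0) {x : L} {d : ℕ}
    (hd : d = Function.minimalPeriod (fun y : L => y ^ p) x) (hd0 : 0 < d) {j : ℕ} :
    frobPoly p d x ^ j ∣ f.map (algebraMap (ZMod p) L) ↔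
      j ≤ (f.map (algebraMap (ZMod p) L)).rootMultiplicity x := by
  have hf' : f.map (algebraMap (ZMod p) L) ≠ 0 :=
    (Polynomial.map_ne_zero_iff (algebraMap (ZMod p) L).injective).2 hf
  rw [le_rootMultiplicity_iff hf']
  constructor
  · intro h
    exact (pow_dvd_pow_of_dvd (X_sub_C_dvd_frobPoly hd0 x) j).trans h
  · intro h
    rw [frobPoly, ← prod_pow]
    refine prod_dvd_of_coprime ?_ fun i _ => pow_dvd_map_of_pow_dvd_map h i
    intro i hi k hk hik
    apply IsCoprime.pow
    apply isCoprime_X_sub_C_of_isUnit_sub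
    rw [isUnit_iff_ne_zero, sub_ne_zero]
    intro h1
    apply hik
    rw [coe_range, Set.mem_Iio] at hi hk
    subst hd
    exact Function.iterate_injOn_Iio_minimalPeriod hi hk (by simpa only [pow_iterate] using h1)

theorem card_frobPoly_dvd [DecidableEq L] {f : (ZMod p)[X]} (hf : f ≠ 0) {n : ℕ}
    (hn : f.natDegree = n) {x : L} (hx : (f.map (algebraMap (ZMod p) L)).IsRoot x)
    [DecidablePred fun k => x ∈ frobFixed p L k ∧
      frobPoly p k x ∣ f.map (algebraMap (ZMod p) L)] :
    #{k ∈ Icc 1 n | x ∈ frobFixed p L k ∧ frobPoly p k x ∣ f.map (algebraMap (ZMod p) L)} =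
      (f.map (algebraMap (ZMod p) L)).rootMultiplicity x := by
  obtain ⟨d, hd⟩ : ∃ d, d = Function.minimalPeriod (fun y : L => y ^ p) x := ⟨_, rfl⟩
  have hd0 : 0 < d := hd ▸ minimalPeriod_pos_of_isRoot hf hx
  have hxd : x ^ p ^ d = x := pow_pow_eq_self_iff.2 (dvd_of_eq hd.symm)
  have hdvd : ∀ {j}, frobPoly p (d * j) x ∣ f.map (algebraMap (ZMod p) L) ↔
      j ≤ (f.map (algebraMap (ZMod p) L)).rootMultiplicity x := fun {j} => by
    rw [frobPoly_mul hxd, frobPoly_minimalPeriod_pow_dvd_iff hf hd hd0]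
  set v := (f.map (algebraMap (ZMod p) L)).rootMultiplicity x
  have : {k ∈ Icc 1 n | x ∈ frobFixed p L k ∧ frobPoly p k x ∣ f.map (algebraMap (ZMod p) L)} =
      (Icc 1 v).image (d * ·) := by
    ext k
    rw [mem_filter, mem_image, mem_Icc]
    constructor
    · rintro ⟨⟨h1, h2⟩, h3, h4⟩
      rw [mem_frobFixed (by omega), pow_pow_eq_self_iff, ← hd] at h3
      obtain ⟨j, rfl⟩ := h3
      exact ⟨j, mem_Icc.2 ⟨Nat.pos_of_ne_zero (by rintro rfl; simp at h1), hdvd.1 h4⟩, rfl⟩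
    · rintro ⟨j, hj, rfl⟩
      obtain ⟨h1, h2⟩ := mem_Icc.1 hj
      have h3 : 0 < d * j := Nat.mul_pos hd0 h1
      refine ⟨⟨h3, ?_⟩, ?_, hdvd.2 h2⟩
      · have h4 := natDegree_le_of_dvd (hdvd.2 h2)
          ((Polynomial.map_ne_zero_iff (algebraMap (ZMod p) L).injective).2 hf)
        rwa [natDegree_map, hn, frobPoly, natDegree_finsetProd_X_sub_C_eq_card, card_range] at h4
      · rw [mem_frobFixed h3.ne', pow_pow_eq_self_iff, ← hd]
        exact dvd_mul_right d j
  rw [this, card_image_of_injective _ (mul_right_injective₀ hd0.ne'), Nat.card_Icc,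
    Nat.add_sub_cancel]

theorem sum_card_frobPoly_dvd [IsAlgClosed L] [DecidableEq L] {f : (ZMod p)[X]} (hf : f ≠ 0)
    {n : ℕ} (hn : f.natDegree = n)
    [∀ k, DecidablePred fun x : L => frobPoly p k x ∣ f.map (algebraMap (ZMod p) L)] :
    ∑ k ∈ Icc 1 n, #{x ∈ frobFixed p L k | frobPoly p k x ∣ f.map (algebraMap (ZMod p) L)} = n := by
  classical
  have hf' : f.map (algebraMap (ZMod p) L) ≠ 0 :=
    (Polynomial.map_ne_zero_iff (algebraMap (ZMod p) L).injective).2 hf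
  set R := (f.map (algebraMap (ZMod p) L)).roots with hR
  have h1 := sum_card_bipartiteAbove_eq_sum_card_bipartiteBelow (s := Icc 1 n) (t := R.toFinset)
    (fun k x => x ∈ frobFixed p L k ∧ frobPoly p k x ∣ f.map (algebraMap (ZMod p) L))
  have h2 : ∀ k ∈ Icc 1 n,
      {x ∈ frobFixed p L k | frobPoly p k x ∣ f.map (algebraMap (ZMod p) L)} =
      {x ∈ R.toFinset | x ∈ frobFixed p L k ∧ frobPoly p k x ∣ f.map (algebraMap (ZMod p) L)} := by
    intro k hk
    ext x
    rw [mem_filter, mem_filter, Multiset.mem_toFinset, hR, mem_roots hf', ← dvd_iff_isRoot]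
    exact ⟨fun h => ⟨(X_sub_C_dvd_frobPoly (mem_Icc.1 hk).1 x).trans h.2, h⟩, fun h => h.2⟩
  have h3 : ∀ x ∈ R.toFinset,
      #{k ∈ Icc 1 n | x ∈ frobFixed p L k ∧ frobPoly p k x ∣ f.map (algebraMap (ZMod p) L)} =
        R.count x := by
    intro x hx
    rw [Multiset.mem_toFinset, hR, mem_roots hf'] at hx
    rw [card_frobPoly_dvd hf hn hx, hR, count_roots]
  calc _ = _ := sum_congr rfl fun k hk => by rw [h2 k hk, bipartiteAbove]
    _ = _ := h1
    _ = _ := sum_congr rfl h3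
    _ = _ := by
      rw [Multiset.toFinset_sum_count_eq, hR, IsAlgClosed.card_roots_eq_natDegree, natDegree_map,
        hn]

theorem exists_monic_map_eq_frobPoly [DecidableEq L] (a : ZMod p) (ψ : AddChar (ZMod p) ℂ) {n : ℕ} (hn : n ≠ 0)
    {x : L} (hx : x ^ p ^ n = x) :
    ∃ g : (ZMod p)[X], g.map (algebraMap (ZMod p) L) = frobPoly p n x ∧ g.Monic ∧
      g.natDegree = n ∧ ∀ c, algebraMap (ZMod p) L c = kloostermanTrace a n x →
        polyChar ψ a g = if x = 0 then 0 else ψ c := by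
  have hp : 0 < p := (Fact.out : p.Prime).pos
  obtain ⟨g, hg⟩ := exists_map_eq_frobPoly hx
  have hinj := (algebraMap (ZMod p) L).injective
  have hmonic : g.Monic := by
    apply monic_of_injective hinj
    rw [hg]
    exact monic_prod_X_sub_C _ _
  refine ⟨g, hg, hmonic, ?_, fun c hc => ?_⟩
  · rw [← natDegree_map (algebraMap (ZMod p) L), hg, frobPoly,
      natDegree_finsetProd_X_sub_C_eq_card, card_range]
  · have h0 : g.coeff 0 = 0 ↔ x = 0 := by
      rw [← map_eq_zero_iff _ hinj, ← coeff_map, hg, coeff_zero_eq_eval_zero, frobPoly, eval_prod,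
        prod_eq_zero_iff]
      constructor
      · rintro ⟨i, -, hi⟩
        simpa [hp.ne'] using hi
      · rintro rfl
        exact ⟨0, mem_range.2 (Nat.pos_of_ne_zero hn), by simp⟩
    rw [polyChar]
    by_cases hx0 : x = 0
    · rw [if_pos (h0.2 hx0), if_pos hx0]
    · rw [if_neg (mt h0.1 hx0), if_neg hx0]
      congr 1
      apply hinj
      rw [← rootTrace_map, hg, hc, frobPoly, kloostermanTrace,
        rootTrace_prod_X_sub_C _ _ fun i _ => pow_ne_zero _ hx0]

theorem kloostermanSum_eq_sum_frobFixed [DecidableEq L] (a : ZMod p) (ψ : AddChar (ZMod p) ℂ)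
    {n : ℕ} {F : L → ℂ} (hF : ∀ x ∈ frobFixed p L n, ∃ c : ZMod p,
      algebraMap (ZMod p) L c = kloostermanTrace a n x ∧ F x = if x = 0 then 0 else ψ c) :
    kloostermanSum L ψ a n = ∑ x ∈ frobFixed p L n, F x := by
  simp only [kloostermanSum, kloostermanCount, card_filter, Nat.cast_sum, mul_sum]
  rw [sum_comm]
  refine sum_congr rfl fun x hx => ?_
  obtain ⟨c, hc, hFx⟩ := hF x hx
  rw [hFx, ← hc]
  by_cases hx0 : x = 0
  · simp [hx0]
  · simp [hx0, (algebraMap (ZMod p) L).injective.eq_iff]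

variable (L) in
theorem natCast_mul_polyCharSum [IsAlgClosed L] [DecidableEq L] (ψ : AddChar (ZMod p) ℂ)
    (a : ZMod p) (n : ℕ) :
    n * polyCharSum ψ a n =
      ∑ k ∈ Icc 1 n, kloostermanSum L ψ a k * polyCharSum ψ a (n - k) := by
  classical
  have hex : ∀ (k : ℕ) (x : L), k ≠ 0 ∧ x ∈ frobFixed p L k → ∃ g : (ZMod p)[X],
      g.map (algebraMap (ZMod p) L) = frobPoly p k x ∧ g.Monic ∧
      g.natDegree = k ∧ ∀ c, algebraMap (ZMod p) L c = kloostermanTrace a k x →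
        polyChar ψ a g = if x = 0 then 0 else ψ c := fun k x h =>
    exists_monic_map_eq_frobPoly a ψ h.1 ((mem_frobFixed h.1).1 h.2)
  choose! g hg using hex
  have h1 : ∀ f ∈ monicFinset p n, ((n : ℕ) : ℂ) * polyChar ψ a f =
      ∑ k ∈ Icc 1 n, ∑ x ∈ frobFixed p L k, if g k x ∣ f then polyChar ψ a f else 0 := by
    intro f hf
    obtain ⟨hf1, hf2⟩ := mem_monicFinset.1 hf
    conv_lhs => rw [← sum_card_frobPoly_dvd (L := L) hf1.ne_zero hf2]
    rw [Nat.cast_sum, sum_mul]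
    refine sum_congr rfl fun k hk => ?_
    rw [← sum_filter, sum_const, nsmul_eq_mul]
    congr 3
    refine filter_congr fun x hx => ?_
    rw [← (hg k x ⟨by have := (mem_Icc.1 hk).1; omega, hx⟩).1, Polynomial.map_dvd_map']
  rw [polyCharSum, mul_sum, sum_congr rfl h1, sum_comm]
  refine sum_congr rfl fun k hk => ?_
  obtain ⟨hk1, hk2⟩ := mem_Icc.1 hk
  have hk0 : k ≠ 0 := by omega
  rw [sum_comm, kloostermanSum_eq_sum_frobFixed a ψ (F := fun x => polyChar ψ a (g k x)), sum_mul]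
  · refine sum_congr rfl fun x hx => ?_
    obtain ⟨-, h2, h3, -⟩ := hg k x ⟨hk0, hx⟩
    rw [← sum_filter, sum_monicFinset_dvd ψ a hk2 h2 h3]
  · intro x hx
    obtain ⟨c, hc⟩ := kloostermanTrace_mem_range a ((mem_frobFixed hk0).1 hx)
    exact ⟨c, hc, (hg k x ⟨hk0, hx⟩).2.2.2 c hc⟩

end Recursion

section WeilBound

theorem kloostermanSum_eq {L : Type*} [Field L] [Algebra (ZMod p) L] [IsAlgClosed L]
    [DecidableEq L] {ψ : AddChar (ZMod p) ℂ} (hψ : ψ ≠ 1) {a : ZMod p} (ha : a ≠ 0) {α β : ℂ}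
    (hadd : α + β = -polyCharSum ψ a 1) (hmul : α * β = p) {n : ℕ} (hn : 1 ≤ n) :
    kloostermanSum L ψ a n = -(α ^ n + β ^ n) := by
  have h1 : kloostermanSum L ψ a 1 = polyCharSum ψ a 1 := by
    simpa [polyCharSum_zero] using (natCast_mul_polyCharSum L ψ a 1).symm
  induction n using Nat.strong_induction_on with
  | _ n ih =>
    match n with
    | 1 => rw [h1]; linear_combination hadd
    | 2 =>
      have h2 := natCast_mul_polyCharSum L ψ a 2
      rw [sum_Icc_succ_top (by norm_num), Icc_self, sum_singleton, h1, polyCharSum_two hψ ha,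
        show 1 + 1 - (1 + 1) = 0 from rfl, show 1 + 1 - 1 = 1 from rfl, polyCharSum_zero] at h2
      push_cast at h2
      linear_combination -h2 - 2 * hmul + (α + β - polyCharSum ψ a 1) * hadd
    | m + 3 =>
      have h2 := natCast_mul_polyCharSum L ψ a (m + 3)
      rw [sum_Icc_succ_top (by omega), sum_Icc_succ_top (by omega), sum_Icc_succ_top (by omega),
        sum_eq_zero, polyCharSum_eq_zero hψ ha (by omega), show m + 3 - (m + 1) = 2 by omega,
        show m + 3 - (m + 1 + 1) = 1 by omega, show m + 3 - (m + 2 + 1) = 0 by omega,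
        polyCharSum_two hψ ha, polyCharSum_zero, ih (m + 1) (by omega) (by omega),
        ih (m + 1 + 1) (by omega) (by omega)] at h2
      · linear_combination -h2 + (α ^ (m + 2) + β ^ (m + 2)) * hadd -
          (α ^ (m + 1) + β ^ (m + 1)) * hmul
      · intro k hk
        rw [polyCharSum_eq_zero hψ ha (by have := mem_Icc.1 hk; omega), mul_zero]

omit [Fact p.Prime] in
theorem norm_sq_le_of_norm_add_pow_le {α β : ℂ} {q C : ℝ} (hq : 0 < q)
    (hmul : ‖α‖ * ‖β‖ = q) {N : ℕ}
    (h : ∀ μ, N ≤ μ → ‖α ^ (2 * μ) + β ^ (2 * μ)‖ ≤ C * q ^ μ) : ‖α‖ ^ 2 ≤ q := by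
  by_contra! hlt
  have hβ : ‖β‖ ^ 2 ≤ q := by
    have h1 : ‖α‖ ^ 2 * ‖β‖ ^ 2 = q * q := by rw [← hmul]; ring
    nlinarith [sq_nonneg ‖β‖]
  obtain ⟨μ, h1, h2⟩ := (((tendsto_pow_atTop_atTop_of_one_lt
    ((one_lt_div hq).2 hlt)).eventually_gt_atTop (C + 1)).and
      (Filter.eventually_ge_atTop N)).exists
  rw [div_pow, lt_div_iff₀ (pow_pos hq μ)] at h1
  have h3 : ‖β‖ ^ (2 * μ) ≤ q ^ μ := by
    rw [pow_mul]
    exact pow_le_pow_left₀ (sq_nonneg _) hβ μ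
  have h4 := norm_sub_le (α ^ (2 * μ) + β ^ (2 * μ)) (β ^ (2 * μ))
  rw [add_sub_cancel_right, norm_pow, norm_pow, pow_mul] at h4
  have h5 := h μ h2
  linarith

/-- The Weil bound for the Kloosterman sum of a nontrivial additive character of `ZMod p`. -/
theorem norm_sum_addChar_add_inv_le (hp2 : p ≠ 2) {ψ : AddChar (ZMod p) ℂ} (hψ : ψ ≠ 1)
    {a : ZMod p} (ha : a ≠ 0) :
    ‖∑ x : ZMod p, if x = 0 then 0 else ψ (a * x + x⁻¹)‖ ≤ 2 * √p := by
  classical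
  have hp0 : (0 : ℝ) < p := by exact_mod_cast (Fact.out : p.Prime).pos
  rw [← polyCharSum_one]
  set t := polyCharSum ψ a 1 with ht
  obtain ⟨α, hα⟩ := IsAlgClosed.exists_root (C 1 * X ^ 2 + C t * X + C (p : ℂ)) (by
    rw [degree_quadratic one_ne_zero]; norm_num)
  obtain ⟨β, hβ⟩ : ∃ β, β = -t - α := ⟨_, rfl⟩
  have hadd : α + β = -t := by rw [hβ]; ring
  have hmul : α * β = p := by
    simp only [IsRoot.def, eval_add, eval_mul, eval_C, eval_pow, eval_X] at hα
    rw [hβ]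
    linear_combination -hα
  have hnorm : ‖α‖ * ‖β‖ = p := by rw [← norm_mul, hmul, Complex.norm_natCast]
  have hbound : ∀ μ, 4 ≤ μ → ‖α ^ (2 * μ) + β ^ (2 * μ)‖ ≤ (4 * p + 6) * (p : ℝ) ^ μ := by
    intro μ hμ
    have h1 := norm_kloostermanSum_le (AlgebraicClosure (ZMod p)) hp2 hψ ha hμ
    rwa [kloostermanSum_eq hψ ha hadd hmul (by omega), norm_neg] at h1
  have h1 := Real.le_sqrt_of_sq_le (norm_sq_le_of_norm_add_pow_le hp0 hnorm hbound)
  have h2 := Real.le_sqrt_of_sq_le (norm_sq_le_of_norm_add_pow_le hp0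
    ((mul_comm _ _).trans hnorm) fun μ hμ => by rw [add_comm]; exact hbound μ hμ)
  have h3 := norm_add_le α β
  rw [hadd, norm_neg] at h3
  linarith

end WeilBound

end Kloosterman

theorem Kl_eq_sum_stdAddChar (p : ℕ) [Fact p.Prime] (a : ℤ) :
    Kl p a = (1 / √p : ℝ) *
      ∑ x : ZMod p, if x = 0 then 0 else ZMod.stdAddChar ((a : ZMod p) * x + x⁻¹) := by
  have hp : p.Prime := Fact.out
  rw [Kl]
  push_cast
  congr 1
  rw [sum_congr rfl fun x _ => (ite_not (x = 0) _ _).symm, ← sum_filter]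
  refine sum_nbij' (fun x => (x : ZMod p)) ZMod.val ?_ ?_ ?_ ?_ ?_
  · intro x hx
    rw [mem_filter, mem_range] at hx
    rw [mem_filter]
    refine ⟨Finset.mem_univ _, ?_⟩
    rw [ZMod.natCast_eq_zero_iff]
    exact (hp.coprime_iff_not_dvd).1 hx.2.symm
  · intro x hx
    rw [mem_filter] at hx
    rw [mem_filter, mem_range]
    refine ⟨ZMod.val_lt x, ?_⟩
    rw [Nat.coprime_comm, hp.coprime_iff_not_dvd, ← ZMod.natCast_eq_zero_iff, ZMod.natCast_zmod_val]
    exact hx.2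
  · intro x hx
    rw [mem_filter, mem_range] at hx
    exact ZMod.val_cast_of_lt hx.1
  · intro x _
    exact ZMod.natCast_zmod_val x
  · intro x _
    have h : (a : ZMod p) * x + (x : ZMod p)⁻¹ =
        ((a * (x : ℤ) + (((x : ZMod p)⁻¹).val : ℤ) : ℤ) : ZMod p) := by
      push_cast
      rw [ZMod.natCast_zmod_val]
    rw [h, ZMod.stdAddChar_coe]
    congr 1
    push_cast
    ring

/-- The Weil bound: for a prime `p` and `gcd(a, p) = 1`, `|K_p(a)| ≤ 2`. -/
theorem stmt_16 (p : ℕ) (hp : p.Prime) (a : ℤ) (ha : Int.gcd a p = 1) :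
    ‖Kl p a‖ ≤ 2 := by
  have : Fact p.Prime := ⟨hp⟩
  have hs : 0 < √(p : ℝ) := Real.sqrt_pos.2 (by exact_mod_cast hp.pos)
  rw [Kl_eq_sum_stdAddChar, norm_mul, Complex.norm_real, Real.norm_of_nonneg (by positivity),
    one_div_mul_eq_div, div_le_iff₀ hs]
  by_cases hp2 : p = 2
  · subst hp2
    have h2 : ‖∑ x : ZMod 2, if x = 0 then 0 else ZMod.stdAddChar ((a : ZMod 2) * x + x⁻¹)‖ ≤
        ∑ x : ZMod 2, (1 : ℝ) :=
      norm_sum_le_of_le _ fun x _ => by split_ifs <;> simp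
    rw [sum_const, card_univ, ZMod.card] at h2
    have h1 : (1 : ℝ) ≤ √2 := Real.one_le_sqrt.2 (by norm_num)
    norm_num at h2 ⊢
    linarith
  · have ha0 : (a : ZMod p) ≠ 0 := by
      rw [Ne, ZMod.intCast_zmod_eq_zero_iff_dvd]
      intro h
      have h1 : p ∣ Int.gcd a p := Int.dvd_gcd h dvd_rfl
      rw [ha] at h1
      exact hp.one_lt.ne' (Nat.dvd_one.1 h1)
    have hψ : (ZMod.stdAddChar : AddChar (ZMod p) ℂ) ≠ 1 := by
      intro h
      have h1 := ZMod.isPrimitive_stdAddChar p one_ne_zero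
      rw [AddChar.mulShift_one] at h1
      exact h1 h
    exact norm_sum_addChar_add_inv_le hp2 hψ ha0
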